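/- arXiv:2506.06489 — 3 statements merged into one kernel-verified Lean document; each statement's English description precedes it below -/
import Mathlib

section
/- Let n ≥ 1, let κ ≥ 2 be a real number, let η > 0, and let 𝒰 : ℝ^n → ℝ be continuously differentiable. Suppose f : [0,T) → ℝ^n \ {0} is differentiable and satisfies the coupled directional–radial system: (d/dt)(f(t)/‖f(t)‖) = η·‖f(t)‖^{κ−2}·P⊥_{f(t)}·∇𝒰(f(t)/‖f(t)‖) and (d/dt)‖f(t)‖ = η·κ·‖f(t)‖^{κ−1}·𝒰(f(t)/‖f(t)‖), where P⊥_θ = I − θθᵀ/‖θ‖² is the orthogonal projection onto the complement of θ. Then for every α > 0, the rescaled function g(t) = α·f(α^{κ−2}·t), defined on [0, T·α^{2−κ}), satisfies the same system of equations with initial condition g(0) = α·f(0). -/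
open scoped RealInnerProductSpace

/-- The coupled directional–radial system approximating the dynamics of a dormant neuron:
the normalized parameters follow a projected gradient flow of the utility `U` at speed
`η ‖θ‖^{κ-2}`, and the norm grows at rate `η κ ‖θ‖^{κ-1} U(θ̄)`, for all times in `[0, T)`. -/
def SatisfiesAGFSystem {n : ℕ} (κ η T : ℝ)
    (U : EuclideanSpace ℝ (Fin n) → ℝ) (f : ℝ → EuclideanSpace ℝ (Fin n)) : Prop :=
  ∀ t ∈ Set.Ico (0 : ℝ) T,
    f t ≠ 0 ∧
    HasDerivAt (fun s => ‖f s‖⁻¹ • f s)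
      ((η * ‖f t‖ ^ (κ - 2)) •
        (gradient U (‖f t‖⁻¹ • f t)
          - (⟪f t, gradient U (‖f t‖⁻¹ • f t)⟫ / ‖f t‖ ^ (2 : ℕ)) • f t)) t ∧
    HasDerivAt (fun s => ‖f s‖) (η * κ * ‖f t‖ ^ (κ - 1) * U (‖f t‖⁻¹ • f t)) t

/-- Scaling symmetry of the directional–radial system: if `f` solves the system on `[0,T)`,
then for every `α > 0` the rescaled trajectory `t ↦ α • f (α^{κ-2} t)` solves the same system
on `[0, T·α^{2-κ})`, with initial condition `α • f 0`. -/
theorem agf_system_scaling_symmetry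
    (n : ℕ) (hn : 1 ≤ n) (κ η T : ℝ) (hκ : 2 ≤ κ) (hη : 0 < η)
    (U : EuclideanSpace ℝ (Fin n) → ℝ) (hU : ContDiff ℝ 1 U)
    (f : ℝ → EuclideanSpace ℝ (Fin n))
    (hf : SatisfiesAGFSystem κ η T U f) :
    ∀ α : ℝ, 0 < α →
      SatisfiesAGFSystem κ η (T * α ^ (2 - κ)) U (fun t => α • f (α ^ (κ - 2) * t)) ∧
      (fun t : ℝ => α • f (α ^ (κ - 2) * t)) 0 = α • f 0 := by
  intro α hα
  refine ⟨?_, by simp⟩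
  intro t ht
  have hc : 0 < α ^ (κ - 2) := Real.rpow_pos_of_pos hα _
  have hcc : α ^ (2 - κ) * α ^ (κ - 2) = 1 := by
    rw [← Real.rpow_add hα]; simp
  have hmem : α ^ (κ - 2) * t ∈ Set.Ico (0 : ℝ) T := by
    refine ⟨mul_nonneg hc.le ht.1, ?_⟩
    have h := mul_lt_mul_of_pos_left ht.2 hc
    calc α ^ (κ - 2) * t < α ^ (κ - 2) * (T * α ^ (2 - κ)) := h
      _ = T * (α ^ (2 - κ) * α ^ (κ - 2)) := by ring
      _ = T := by rw [hcc, mul_one]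
  obtain ⟨h0, h1, h2⟩ := hf _ hmem
  have hlin : HasDerivAt (fun s : ℝ => α ^ (κ - 2) * s) (α ^ (κ - 2)) t := by
    simpa using (hasDerivAt_id t).const_mul (α ^ (κ - 2))
  have hn' : ∀ v : EuclideanSpace ℝ (Fin n), ‖α • v‖ = α * ‖v‖ := fun v => by
    rw [norm_smul, Real.norm_of_nonneg hα.le]
  have hd : ∀ v : EuclideanSpace ℝ (Fin n), ‖α • v‖⁻¹ • (α • v) = ‖v‖⁻¹ • v := fun v => by
    rw [hn', smul_smul]
    congr 1
    rw [mul_inv]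
    field_simp
  have e1 := HasDerivAt.scomp t h1 hlin
  have e2 := (HasDerivAt.comp t h2 hlin).const_mul α
  refine ⟨smul_ne_zero hα.ne' h0, ?_, ?_⟩
  · simp only [hd]
    refine e1.congr_deriv ?_
    simp only [hn']
    generalize f (α ^ (κ - 2) * t) = v at *
    have hv : 0 < ‖v‖ := norm_pos_iff.mpr h0
    rw [Real.mul_rpow hα.le hv.le, smul_smul, smul_smul, real_inner_smul_left]
    congr 1
    · ring
    · congr 2
      field_simp
  · simp only [hd]
    simp only [hn']
    refine e2.congr_deriv ?_
    generalize f (α ^ (κ - 2) * t) = v at *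
    have hv : 0 < ‖v‖ := norm_pos_iff.mpr h0
    have ha : α ^ (κ - 1) = α * α ^ (κ - 2) := by
      rw [show κ - 1 = 1 + (κ - 2) by ring, Real.rpow_add hα, Real.rpow_one]
    rw [Real.mul_rpow hα.le hv.le, ha]
    ring
end

section
/- Let κ ≥ 2 be a real number, η > 0, T > 0, and let u : [0,T) → ℝ be continuous. Define the accumulated utility S(t) = ∫₀ᵗ κ·u(s) ds. Suppose r : [0,T) → (0,∞) is differentiable with r(0) = r₀ > 0 and satisfies r'(t) = η·κ·r(t)^{κ−1}·u(t) for all t ∈ [0,T). Then: (i) if κ = 2, r(t) = r₀·exp(η·S(t)) for all t ∈ [0,T); (ii) if κ > 2, r(t) = (r₀^{2−κ} + (2−κ)·η·S(t))^{1/(2−κ)} for all t ∈ [0,T). -/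
theorem radial_aux (κ T c : ℝ) (u : ℝ → ℝ) (hu : ContinuousOn u (Set.Ico 0 T)) (g : ℝ → ℝ)
    (hg : ∀ t ∈ Set.Ico (0 : ℝ) T, HasDerivWithinAt g (c * (κ * u t)) (Set.Ico 0 T) t) :
    ∀ t ∈ Set.Ico (0 : ℝ) T, g t = g 0 + c * ∫ s in (0 : ℝ)..t, κ * u s := by
  intro t ht
  have hsub : Set.Icc 0 t ⊆ Set.Ico 0 T := fun x hx => ⟨hx.1, lt_of_le_of_lt hx.2 ht.2⟩
  have hcont : ContinuousOn g (Set.Icc 0 t) := fun x hx =>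
    ((hg x (hsub hx)).continuousWithinAt).mono hsub
  have hint : IntervalIntegrable (fun s => c * (κ * u s)) MeasureTheory.volume 0 t := by
    apply ContinuousOn.intervalIntegrable
    rw [Set.uIcc_of_le ht.1]
    exact continuousOn_const.mul (continuousOn_const.mul (hu.mono hsub))
  have := intervalIntegral.integral_eq_sub_of_hasDerivAt_of_le ht.1 hcont
    (fun x hx => (hg x (hsub ⟨hx.1.le, hx.2.le⟩)).hasDerivAt
      (Ico_mem_nhds hx.1 (hx.2.trans ht.2))) hint
  rw [intervalIntegral.integral_const_mul] at this
  linarith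

/-- Closed form of the radial dynamics of a dormant neuron: if the norm `r` satisfies
`r' = η κ r^{κ-1} u(t)` on `[0,T)` with `r(0) = r₀ > 0`, and `S(t) = ∫₀ᵗ κ u(s) ds` is the
accumulated utility, then `r(t) = r₀ exp(η S(t))` when `κ = 2`, and
`r(t) = (r₀^{2-κ} + (2-κ) η S(t))^{1/(2-κ)}` when `κ > 2`. -/
theorem radial_dynamics_closed_form
    (κ η T r₀ : ℝ) (hκ : 2 ≤ κ) (hη : 0 < η) (hT : 0 < T) (hr₀ : 0 < r₀)
    (u : ℝ → ℝ) (hu : ContinuousOn u (Set.Ico 0 T))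
    (r : ℝ → ℝ) (hrpos : ∀ t ∈ Set.Ico (0 : ℝ) T, 0 < r t)
    (hr0 : r 0 = r₀)
    (hode : ∀ t ∈ Set.Ico (0 : ℝ) T,
      HasDerivWithinAt r (η * κ * r t ^ (κ - 1) * u t) (Set.Ico 0 T) t) :
    (κ = 2 → ∀ t ∈ Set.Ico (0 : ℝ) T,
      r t = r₀ * Real.exp (η * ∫ s in (0 : ℝ)..t, κ * u s)) ∧
    (2 < κ → ∀ t ∈ Set.Ico (0 : ℝ) T,
      r t = (r₀ ^ (2 - κ) + (2 - κ) * η * ∫ s in (0 : ℝ)..t, κ * u s) ^ (1 / (2 - κ))) := by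
  have h0 : (0 : ℝ) ∈ Set.Ico 0 T := ⟨le_rfl, hT⟩
  constructor
  · intro hk t ht
    have key := radial_aux κ T η u hu (fun t => Real.log (r t)) (fun t ht => by
      have h := (hode t ht).log (hrpos t ht).ne'
      convert h using 1
      have hp := (hrpos t ht).ne'
      rw [show κ - 1 = 1 by linarith, Real.rpow_one]
      field_simp) t ht
    simp only [hr0] at key
    rw [← Real.exp_log (hrpos t ht), key, Real.exp_add, Real.exp_log hr₀]
  · intro hk t ht
    have key := radial_aux κ T ((2 - κ) * η) u hu (fun t => r t ^ (2 - κ)) (fun t ht => by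
      have h := (hode t ht).rpow_const (p := 2 - κ) (Or.inl (hrpos t ht).ne')
      convert h using 1
      have hp : r t ^ (κ - 1) * r t ^ (2 - κ - 1) = 1 := by
        rw [← Real.rpow_add (hrpos t ht), show κ - 1 + (2 - κ - 1) = 0 by ring, Real.rpow_zero]
      linear_combination (-((2 - κ) * η * (κ * u t))) * hp) t ht
    simp only [hr0] at key
    rw [← key, ← Real.rpow_mul (hrpos t ht).le, mul_one_div_cancel (by linarith), Real.rpow_one]
end

section
/- Let M be a real symmetric positive semidefinite d×d matrix with largest eigenvalue λ. Then sup{ V·(qᵀ M k) : V ∈ ℝ, q, k ∈ ℝ^d, V² + ‖q‖² + ‖k‖² = 1 } = λ/(3√3), and the supremum is attained at V = 1/√3, q = k = v/√3, where v is any unit eigenvector of M with eigenvalue λ. -/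
open scoped Matrix

theorem crq_psd_le {d : ℕ} (M : Matrix (Fin d) (Fin d) ℝ) (hM : M.PosSemidef) (lam : ℝ)
    (hmax : ∀ (μ : ℝ) (u : Fin d → ℝ), u ≠ 0 → M.mulVec u = μ • u → μ ≤ lam)
    (u : Fin d → ℝ) : u ⬝ᵥ M.mulVec u ≤ lam * ∑ i, u i ^ 2 := by
  have hH : (lam • (1 : Matrix (Fin d) (Fin d) ℝ) - M).IsHermitian := by
    refine Matrix.IsHermitian.sub ?_ hM.1
    simp [Matrix.IsHermitian]
  have hP : (lam • (1 : Matrix (Fin d) (Fin d) ℝ) - M).PosSemidef := by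
    rw [hH.posSemidef_iff_eigenvalues_nonneg]
    intro j
    have h := hH.mulVec_eigenvectorBasis j
    have hne : (hH.eigenvectorBasis j).ofLp ≠ 0 := by
      intro h0
      have h1 := hH.eigenvectorBasis.orthonormal.ne_zero j
      apply h1
      ext i
      exact congrFun h0 i
    rw [Matrix.sub_mulVec, Matrix.smul_mulVec, Matrix.one_mulVec] at h
    have := hmax (lam - hH.eigenvalues j) _ hne (by
      rw [sub_smul, ← h]; abel)
    simp only [Pi.zero_apply]
    linarith
  have h := hP.dotProduct_mulVec_nonneg u
  rw [Matrix.sub_mulVec, Matrix.smul_mulVec, Matrix.one_mulVec, dotProduct_sub,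
    dotProduct_smul] at h
  simp only [star_trivial, smul_eq_mul] at h
  have h2 : u ⬝ᵥ u = ∑ i, u i ^ 2 := by simp [dotProduct, sq]
  rw [h2] at h
  linarith

theorem crq_attain {d : ℕ} (M : Matrix (Fin d) (Fin d) ℝ) (lam : ℝ)
    (v : Fin d → ℝ) (hv : (∑ i, v i ^ 2) = 1) (hMv : M.mulVec v = lam • v) :
    (1 / Real.sqrt 3) ^ 2 + (∑ i, ((Real.sqrt 3)⁻¹ • v) i ^ 2)
          + (∑ i, ((Real.sqrt 3)⁻¹ • v) i ^ 2) = 1 ∧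
      (1 / Real.sqrt 3) * (((Real.sqrt 3)⁻¹ • v) ⬝ᵥ M.mulVec ((Real.sqrt 3)⁻¹ • v))
        = lam / (3 * Real.sqrt 3) := by
  have h3 : Real.sqrt 3 ^ 2 = 3 := Real.sq_sqrt (by norm_num)
  have hpos : 0 < Real.sqrt 3 := Real.sqrt_pos.mpr (by norm_num)
  have h2 : v ⬝ᵥ v = 1 := by rw [← hv]; simp [dotProduct, sq]
  constructor
  · simp only [Pi.smul_apply, smul_eq_mul, mul_pow, ← Finset.mul_sum, hv, inv_pow, div_pow, h3]
    norm_num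
  · rw [Matrix.mulVec_smul, hMv, smul_dotProduct, dotProduct_smul, dotProduct_smul, h2]
    simp only [smul_eq_mul]
    field_simp
    rw [h3]; ring

/-- The cubic Rayleigh quotient problem for a rank-one attention head: for a symmetric
positive semidefinite matrix `M` with largest eigenvalue `lam`, the supremum of
`V·(qᵀ M k)` over `V² + ‖q‖² + ‖k‖² = 1` equals `lam/(3√3)`, attained at `V = 1/√3`,
`q = k = v/√3` for any unit eigenvector `v` of `M` with eigenvalue `lam`. -/
theorem cubic_rayleigh_quotient_max
    (d : ℕ) (M : Matrix (Fin d) (Fin d) ℝ) (hM : M.PosSemidef)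
    (lam : ℝ)
    (heig : ∃ v : Fin d → ℝ, (∑ i, v i ^ 2) = 1 ∧ M.mulVec v = lam • v)
    (hmax : ∀ (μ : ℝ) (u : Fin d → ℝ), u ≠ 0 → M.mulVec u = μ • u → μ ≤ lam) :
    IsGreatest
      {r : ℝ | ∃ (V : ℝ) (q k : Fin d → ℝ),
        V ^ 2 + (∑ i, q i ^ 2) + (∑ i, k i ^ 2) = 1 ∧ r = V * (q ⬝ᵥ M.mulVec k)}
      (lam / (3 * Real.sqrt 3)) ∧
    ∀ v : Fin d → ℝ, (∑ i, v i ^ 2) = 1 → M.mulVec v = lam • v →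
      (1 / Real.sqrt 3) ^ 2 + (∑ i, ((Real.sqrt 3)⁻¹ • v) i ^ 2)
          + (∑ i, ((Real.sqrt 3)⁻¹ • v) i ^ 2) = 1 ∧
      (1 / Real.sqrt 3) * (((Real.sqrt 3)⁻¹ • v) ⬝ᵥ M.mulVec ((Real.sqrt 3)⁻¹ • v))
        = lam / (3 * Real.sqrt 3) := by
  refine ⟨⟨?_, ?_⟩, fun v hv hMv => crq_attain M lam v hv hMv⟩
  · obtain ⟨v, hv, hMv⟩ := heig
    have h := crq_attain M lam v hv hMv
    exact ⟨_, _, _, h.1, h.2.symm⟩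
  · rintro r ⟨V, q, k, hs, rfl⟩
    have hlam : 0 ≤ lam := by
      obtain ⟨v, hv, hMv⟩ := heig
      have h := hM.dotProduct_mulVec_nonneg v
      have h2 : v ⬝ᵥ v = 1 := by rw [← hv]; simp [dotProduct, sq]
      rw [hMv, dotProduct_smul] at h
      simpa [h2] using h
    have hsym : k ⬝ᵥ M.mulVec q = q ⬝ᵥ M.mulVec k := by
      have hT : Mᵀ = M := by simpa using hM.1.eq
      rw [Matrix.dotProduct_mulVec, ← Matrix.mulVec_transpose, hT, dotProduct_comm]
    have hq := crq_psd_le M hM lam hmax q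
    have hk := crq_psd_le M hM lam hmax k
    have hm := hM.dotProduct_mulVec_nonneg (q - k)
    have hp := hM.dotProduct_mulVec_nonneg (q + k)
    simp only [star_trivial, Matrix.mulVec_sub, Matrix.mulVec_add, dotProduct_sub,
      dotProduct_add, sub_dotProduct, add_dotProduct, hsym] at hm hp
    have hsum : (∑ i, q i ^ 2) + (∑ i, k i ^ 2) = 1 - V ^ 2 := by linarith
    have hb : lam * (∑ i, q i ^ 2) + lam * (∑ i, k i ^ 2) = lam * (1 - V ^ 2) := by
      rw [← hsum]; ring
    have hW : |q ⬝ᵥ M.mulVec k| ≤ lam * (1 - V ^ 2) / 2 := by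
      rw [abs_le]; constructor <;> linarith
    have hVW : V * (q ⬝ᵥ M.mulVec k) ≤ |V| * (lam * (1 - V ^ 2) / 2) :=
      (le_abs_self _).trans (by rw [abs_mul]; gcongr)
    refine hVW.trans ?_
    have h3 : Real.sqrt 3 ^ 2 = 3 := Real.sq_sqrt (by norm_num)
    have hpos : 0 < Real.sqrt 3 := Real.sqrt_pos.mpr (by norm_num)
    obtain ⟨t, ht⟩ : ∃ t, t = (Real.sqrt 3)⁻¹ := ⟨_, rfl⟩
    have ht0 : 0 < t := ht ▸ inv_pos.mpr hpos
    have ht2 : t ^ 2 = 1 / 3 := by rw [ht, inv_pow, h3]; norm_num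
    have he : lam / (3 * Real.sqrt 3) = lam * (t / 3) := by rw [ht]; field_simp
    rw [he, ← sq_abs V]
    have hx := abs_nonneg V
    generalize |V| = x at hx
    have hc : x * (1 - x ^ 2) / 2 ≤ t / 3 := by
      have h := mul_nonneg (sq_nonneg (x - t)) (by linarith : 0 ≤ x + 2 * t)
      have e : (x - t) ^ 2 * (x + 2 * t) = x ^ 3 - 3 * t ^ 2 * x + 2 * t * t ^ 2 := by ring
      rw [e, ht2] at h
      linarith
    calc x * (lam * (1 - x ^ 2) / 2) = lam * (x * (1 - x ^ 2) / 2) := by ring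
      _ ≤ _ := mul_le_mul_of_nonneg_left hc hlam
end
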